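/- Let G be a finite connected simple graph with vertices u₁, …, u_n and edge-length function l, and let G̃ be obtained from G by adding a new vertex u_{n+1} joined to u_n by a single edge; for t > 0 let l_t extend l by assigning length t to the new edge u_n u_{n+1}. Then the largest eigenvalue of the Fujiwara Laplacian of (G̃, l_t) diverges to +∞ as t → 0⁺. -/

import Mathlib

open Finset Filter Topology
open scoped Classical ENNReal

noncomputable section

variable {V : Type*} [Fintype V]

/-- The set of neighbors of `u` as a `Finset`. -/
def nbr (G : SimpleGraph V) (u : V) : Finset V :=
  Finset.univ.filter (fun v => G.Adj u v)

/-- The vertex-weight `m₀(u) = ∑_{v ∼ u} l(uv)` induced by the edge-length function `l`. -/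
def m0 (G : SimpleGraph V) (l : V → V → ℝ) (u : V) : ℝ :=
  ∑ v ∈ nbr G u, l u v

/-- The Fujiwara Laplacian `(Δ_l φ)(u) = ∑_{v ∼ u} (m₁(uv)/m₀(u)) (φ(u) − φ(v))`,
where `m₁(uv) = 1/l(uv)`. -/
def lap (G : SimpleGraph V) (l : V → V → ℝ) (φ : V → ℝ) (u : V) : ℝ :=
  ∑ v ∈ nbr G u, ((1 / l u v) / m0 G l u) * (φ u - φ v)

/-- `l` is an edge-length function: symmetric and positive on adjacent pairs. -/
def IsLength (G : SimpleGraph V) (l : V → V → ℝ) : Prop :=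
  (∀ u v, l u v = l v u) ∧ ∀ u v, G.Adj u v → 0 < l u v

/-- The Dirichlet energy `∑_{uv ∈ E} m₁(uv) (φ(u) − φ(v))²`
(each edge counted once, via half the sum over ordered adjacent pairs). -/
def energy (G : SimpleGraph V) (l : V → V → ℝ) (φ : V → ℝ) : ℝ :=
  (1/2) * ∑ u, ∑ v ∈ nbr G u, (1 / l u v) * (φ u - φ v) ^ 2

/-- The squared norm `∑_{u ∈ V} m₀(u) φ(u)²`. -/
def mass (G : SimpleGraph V) (l : V → V → ℝ) (φ : V → ℝ) : ℝ :=
  ∑ u, m0 G l u * φ u ^ 2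

/-- The first nonzero eigenvalue of the Fujiwara Laplacian, via its variational
characterization as the infimum of the Rayleigh quotient over nonzero functions
orthogonal to the constants. -/
def lambda1 (G : SimpleGraph V) (l : V → V → ℝ) : ℝ :=
  sInf { r | ∃ φ : V → ℝ, φ ≠ 0 ∧ (∑ u, m0 G l u * φ u) = 0 ∧
    r = energy G l φ / mass G l φ }

/-- The largest eigenvalue of the Fujiwara Laplacian, via its variational
characterization as the supremum of the Rayleigh quotient. -/
def lambdaMax (G : SimpleGraph V) (l : V → V → ℝ) : ℝ :=
  sSup { r | ∃ φ : V → ℝ, φ ≠ 0 ∧ r = energy G l φ / mass G l φ }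

/-- `Λ₁(G)`: the supremum, in `[0, ∞]`, of `λ₁(G, l)` over all edge-length functions `l`
normalized by `∑_{u ∈ V} m₀(u) = 1`. -/
def Lambda1 (G : SimpleGraph V) : ℝ≥0∞ :=
  ⨆ (l : V → V → ℝ) (_ : IsLength G l ∧ (∑ u, m0 G l u) = 1),
    ENNReal.ofReal (lambda1 G l)

/-- `μ` is the nondecreasing sequence of eigenvalues (with multiplicity) of the
Fujiwara Laplacian `Δ_l`: it is monotone and admits a corresponding family of
eigenfunctions that is orthonormal for the inner product `⟨φ, ψ⟩ = ∑ m₀(u) φ(u) ψ(u)`. -/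
def IsLapEigSeq (G : SimpleGraph V) (l : V → V → ℝ)
    (μ : Fin (Fintype.card V) → ℝ) : Prop :=
  Monotone μ ∧ ∃ φ : Fin (Fintype.card V) → V → ℝ,
    (∀ i u, lap G l (φ i) u = μ i * φ i u) ∧
    (∀ i j, (∑ u, m0 G l u * φ i u * φ j u) = if i = j then 1 else 0)


/-- The graph `G̃` obtained from `G` by adding a new pendant vertex (`none`) joined
to the vertex `x` by a single edge; the old vertices are embedded via `some`. -/
def addLeaf (G : SimpleGraph V) (x : V) : SimpleGraph (Option V) :=
  SimpleGraph.fromRel (fun a b =>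
    (∃ u v, a = some u ∧ b = some v ∧ G.Adj u v) ∨ (a = some x ∧ b = none))

/-- The edge-length function on `G̃` extending `l`, where the new pendant edge is
given length `t`. -/
def extLen (l : V → V → ℝ) (t : ℝ) : Option V → Option V → ℝ
  | some u, some v => l u v
  | _, _ => t

theorem m0_pos {G : SimpleGraph V} {l : V → V → ℝ} (hl : IsLength G l) {u v : V}
    (huv : G.Adj u v) : 0 < m0 G l u := by
  refine Finset.sum_pos (fun w hw => hl.2 u w ?_) ⟨v, ?_⟩
  · simpa [nbr] using hw
  · simpa [nbr] using huv

theorem mass_nonneg {G : SimpleGraph V} {l : V → V → ℝ} (hm : ∀ u, 0 < m0 G l u) (φ : V → ℝ) :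
    0 ≤ mass G l φ :=
  Finset.sum_nonneg fun u _ => mul_nonneg (hm u).le (sq_nonneg _)

theorem sq_le_mass_div {G : SimpleGraph V} {l : V → V → ℝ} (hm : ∀ u, 0 < m0 G l u)
    (φ : V → ℝ) (u : V) : φ u ^ 2 ≤ mass G l φ / m0 G l u := by
  rw [le_div_iff₀ (hm u), mul_comm]
  exact Finset.single_le_sum (f := fun u => m0 G l u * φ u ^ 2)
    (fun v _ => mul_nonneg (hm v).le (sq_nonneg _)) (Finset.mem_univ u)

/-- The Rayleigh quotients are bounded above as soon as all vertex-weights are positive. -/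
theorem bddAbove_rayleigh {G : SimpleGraph V} {l : V → V → ℝ} (hl : IsLength G l)
    (hm : ∀ u, 0 < m0 G l u) :
    BddAbove { r | ∃ φ : V → ℝ, φ ≠ 0 ∧ r = energy G l φ / mass G l φ } := by
  set K : ℝ := (1 / 2) * ∑ u, ∑ v ∈ nbr G u,
    (1 / l u v) * (2 * (1 / m0 G l u + 1 / m0 G l v)) with hK
  have hlpos : ∀ u, ∀ v ∈ nbr G u, 0 ≤ 1 / l u v := fun u v hv =>
    one_div_nonneg.2 (hl.2 u v (by simpa [nbr] using hv)).le
  have hK0 : 0 ≤ K := by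
    refine mul_nonneg (by norm_num) (Finset.sum_nonneg fun u _ => Finset.sum_nonneg fun v hv => ?_)
    have := hm u
    have := hm v
    exact mul_nonneg (hlpos u v hv) (by positivity)
  refine ⟨K, ?_⟩
  rintro _ ⟨φ, -, rfl⟩
  refine div_le_of_le_mul₀ (mass_nonneg hm φ) hK0 ?_
  rw [hK, energy, mul_assoc, Finset.sum_mul]
  simp only [Finset.sum_mul]
  refine mul_le_mul_of_nonneg_left (Finset.sum_le_sum fun u _ => Finset.sum_le_sum fun v hv => ?_)
    (by norm_num)
  rw [mul_assoc]
  refine mul_le_mul_of_nonneg_left ?_ (hlpos u v hv)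
  have hu := sq_le_mass_div hm φ u
  have hv := sq_le_mass_div hm φ v
  calc (φ u - φ v) ^ 2 ≤ 2 * (φ u ^ 2 + φ v ^ 2) := by nlinarith [sq_nonneg (φ u + φ v)]
    _ ≤ 2 * (mass G l φ / m0 G l u + mass G l φ / m0 G l v) := by gcongr
    _ = 2 * (1 / m0 G l u + 1 / m0 G l v) * mass G l φ := by ring

theorem addLeaf_adj_none_iff {W : Type*} {G : SimpleGraph W} {x : W} {a : Option W} :
    (addLeaf G x).Adj none a ↔ a = some x := by
  cases a <;> simp [addLeaf]

theorem addLeaf_adj_some_none {W : Type*} {G : SimpleGraph W} {x : W} :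
    (addLeaf G x).Adj (some x) none :=
  (addLeaf_adj_none_iff.2 rfl).symm

theorem addLeaf_adj_some_some {W : Type*} {G : SimpleGraph W} {x u v : W} :
    (addLeaf G x).Adj (some u) (some v) ↔ G.Adj u v := by
  simp only [addLeaf, SimpleGraph.fromRel_adj]
  constructor
  · rintro ⟨-, h | h⟩
    · simpa using h
    · simpa [G.adj_comm] using h
  · intro h
    exact ⟨by simpa using h.ne, Or.inl (Or.inl ⟨u, v, rfl, rfl, h⟩)⟩

theorem isLength_extLen {W : Type*} {G : SimpleGraph W} {l : W → W → ℝ} (hl : IsLength G l)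
    (x : W) {t : ℝ} (ht : 0 < t) : IsLength (addLeaf G x) (extLen l t) := by
  refine ⟨?_, ?_⟩
  · rintro (_ | u) (_ | v) <;> simp [extLen, hl.1]
  · rintro (_ | u) (_ | v) h
    · exact ht
    · exact ht
    · exact ht
    · exact hl.2 u v (addLeaf_adj_some_some.1 h)

theorem exists_addLeaf_adj {W : Type*} {G : SimpleGraph W} (hconn : G.Connected) (x : W)
    (a : Option W) :
    ∃ b, (addLeaf G x).Adj a b := by
  rcases a with _ | u
  · exact ⟨some x, addLeaf_adj_none_iff.2 rfl⟩
  · by_cases hux : u = x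
    · exact ⟨none, hux ▸ addLeaf_adj_some_none⟩
    · have : Nontrivial W := ⟨u, x, hux⟩
      obtain ⟨v, hv⟩ := hconn.preconnected.exists_adj_of_nontrivial u
      exact ⟨some v, addLeaf_adj_some_some.2 hv⟩

theorem nbr_addLeaf_none (G : SimpleGraph V) (x : V) : nbr (addLeaf G x) none = {some x} := by
  ext a
  simp [nbr, addLeaf_adj_none_iff]

theorem mass_single [DecidableEq V] (G : SimpleGraph V) (l : V → V → ℝ) (a : V) :
    mass G l (Pi.single a 1) = m0 G l a := by
  rw [mass, Finset.sum_eq_single a]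
  · simp
  · intro b _ hb
    simp [Pi.single_eq_of_ne hb]
  · simp

/-- The indicator function of a vertex has energy at least `(1/2) ∑_{v ∼ a} m₁(av)`. -/
theorem half_sum_le_energy_single [DecidableEq V] {G : SimpleGraph V} {l : V → V → ℝ}
    (hl : IsLength G l) (a : V) :
    (1 / 2) * ∑ v ∈ nbr G a, 1 / l a v ≤ energy G l (Pi.single a 1) := by
  have hlpos : ∀ u, ∀ v ∈ nbr G u, 0 ≤ 1 / l u v := fun u v hv =>
    one_div_nonneg.2 (hl.2 u v (by simpa [nbr] using hv)).le
  refine mul_le_mul_of_nonneg_left ?_ (by norm_num)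
  refine le_trans (le_of_eq (Finset.sum_congr rfl fun v hv => ?_)) (Finset.single_le_sum
    (f := fun u => ∑ v ∈ nbr G u,
      (1 / l u v) * ((Pi.single a 1 : V → ℝ) u - (Pi.single a 1 : V → ℝ) v) ^ 2)
    (fun u _ => Finset.sum_nonneg fun v hv => mul_nonneg (hlpos u v hv) (sq_nonneg _))
    (Finset.mem_univ a))
  have hav : G.Adj a v := by simpa [nbr] using hv
  simp [Pi.single_eq_of_ne hav.ne']

/-- Testing the Rayleigh quotient with the indicator function of the new vertex. -/
theorem le_lambdaMax_addLeaf {G : SimpleGraph V} (hconn : G.Connected) {l : V → V → ℝ}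
    (hl : IsLength G l) (x : V) {t : ℝ} (ht : 0 < t) :
    (1 / 2) * t⁻¹ ^ 2 ≤ lambdaMax (addLeaf G x) (extLen l t) := by
  have hL := isLength_extLen hl x ht
  have hm : ∀ a, 0 < m0 (addLeaf G x) (extLen l t) a := fun a =>
    (exists_addLeaf_adj hconn x a).elim fun _ h => m0_pos hL h
  refine le_trans ?_ (le_csSup (bddAbove_rayleigh hL hm) ⟨Pi.single none 1, by simp, rfl⟩)
  have hE := half_sum_le_energy_single hL none
  have hM : m0 (addLeaf G x) (extLen l t) none = t := by simp [m0, nbr_addLeaf_none, extLen]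
  rw [nbr_addLeaf_none, Finset.sum_singleton] at hE
  rw [mass_single, hM, le_div_iff₀ ht]
  refine le_trans (le_of_eq ?_) hE
  simp only [extLen]
  field_simp

/-- Adding to `(G, l)` a pendant vertex joined to `x` by an edge of length `t`,
the largest eigenvalue of the Fujiwara Laplacian of `(G̃, l_t)` diverges to `+∞`
as `t → 0⁺`. -/
theorem addLeaf_lambdaMax_tendsto_atTop {V : Type*} [Fintype V]
    (G : SimpleGraph V) (hconn : G.Connected) (l : V → V → ℝ) (hl : IsLength G l) (x : V) :
    Filter.Tendsto (fun t : ℝ => lambdaMax (addLeaf G x) (extLen l t))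
      (nhdsWithin 0 (Set.Ioi 0)) Filter.atTop := by
  refine tendsto_atTop_mono' _ (f₁ := fun t : ℝ => (1 / 2) * t⁻¹ ^ 2) ?_ ?_
  · filter_upwards [self_mem_nhdsWithin] with t ht
    exact le_lambdaMax_addLeaf hconn hl x ht
  · exact ((tendsto_pow_atTop two_ne_zero).comp tendsto_inv_nhdsGT_zero).const_mul_atTop
      (by norm_num)

end
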